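/- Square of R_g: let a fusion ring with dimension function d carry an E-grading deg, where E is a finite group in which g·g = 1 for every g, together with weakly integral graded data (n_g, a_x); set R_g := Σ_{x∈C_g} a_x·x and R_0 := R_1. Then for every g ∈ E and every simple z: Σ_{x,y : deg x = deg y = g} a_x·a_y·N^z_{xy} equals (Σ_{w∈C_g} a_w²)·d(z) if deg(z) = 1, and equals 0 otherwise; i.e. R_g ⊗ R_g = (Σ_{w∈C_g} a_w²)·R_0. If moreover the grading is faithful, then Σ_{w∈C_g} a_w² = dim(C_0)/n_g, where dim(C_0) := Σ_{x∈C_1} d(x)². -/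

import Mathlib

open scoped BigOperators

/-- The dimension formula for `x ⊗ y` only involves simples of degree `deg x * deg y`. -/
theorem sum_filter_deg_fusion_mul_dim {I E : Type*} [Fintype I] [Mul E] [DecidableEq E]
    {N : I → I → I → ℕ} {d : I → ℝ} {deg : I → E}
    (hd_mul : ∀ x y, d x * d y = ∑ z : I, (N x y z : ℝ) * d z)
    (hdeg_mul : ∀ x y z, 0 < N x y z → deg z = deg x * deg y)
    {x y : I} {k : E} (hk : deg x * deg y = k) :
    ∑ z ∈ Finset.univ.filter (fun z => deg z = k), (N x y z : ℝ) * d z = d x * d y := by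
  rw [hd_mul, Finset.sum_filter_of_ne]
  intro z _ hz
  rw [← hk]
  refine hdeg_mul x y z (Nat.pos_of_ne_zero fun h => hz ?_)
  simp [h]

/-- In a graded fusion ring, a nonempty component has the same dimension as the trivial one. -/
theorem sum_filter_deg_dim_sq {I E : Type*} [Fintype I] [Group E] [DecidableEq E]
    {star : I → I} {N : I → I → I → ℕ} {d : I → ℝ} {deg : I → E}
    (h_frob : ∀ x y z : I, N x y z = N (star x) z y)
    (hd_pos : ∀ x, 0 < d x)
    (hd_star : ∀ x, d (star x) = d x)
    (hd_mul : ∀ x y, d x * d y = ∑ z : I, (N x y z : ℝ) * d z)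
    (hdeg_star : ∀ x, deg (star x) = (deg x)⁻¹)
    (hdeg_mul : ∀ x y z, 0 < N x y z → deg z = deg x * deg y) (x : I) :
    ∑ y ∈ Finset.univ.filter (fun y => deg y = deg x), d y ^ 2
      = ∑ z ∈ Finset.univ.filter (fun z => deg z = 1), d z ^ 2 := by
  refine mul_left_cancel₀ (hd_pos x).ne' ?_
  calc d x * ∑ y ∈ Finset.univ.filter (fun y => deg y = deg x), d y ^ 2
      = ∑ y ∈ Finset.univ.filter (fun y => deg y = deg x),
          ∑ z ∈ Finset.univ.filter (fun z => deg z = 1), d y * ((N x z y : ℝ) * d z) := by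
        rw [Finset.mul_sum]
        refine Finset.sum_congr rfl fun y hy => ?_
        rw [Finset.mem_filter] at hy
        simp only [h_frob x]
        rw [← Finset.mul_sum,
          sum_filter_deg_fusion_mul_dim hd_mul hdeg_mul (by simp [hdeg_star, hy.2]), hd_star]
        ring
    _ = ∑ z ∈ Finset.univ.filter (fun z => deg z = 1),
          d z * ∑ y ∈ Finset.univ.filter (fun y => deg y = deg x), (N x z y : ℝ) * d y := by
        rw [Finset.sum_comm]
        simp only [Finset.mul_sum]
        refine Finset.sum_congr rfl fun z _ => Finset.sum_congr rfl fun y _ => ?_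
        ring
    _ = d x * ∑ z ∈ Finset.univ.filter (fun z => deg z = 1), d z ^ 2 := by
        rw [Finset.mul_sum]
        refine Finset.sum_congr rfl fun z hz => ?_
        rw [Finset.mem_filter] at hz
        rw [sum_filter_deg_fusion_mul_dim hd_mul hdeg_mul (by simp [hz.2])]
        ring

/-- **Square of `R_g`**: for a fusion ring `(I, one, star, N)` with dimension
function `d`, an `E`-grading `deg` where every element of `E` squares to the
identity, and weakly integral graded data `(n, a)`, setting
`R_g = ∑_{x ∈ C_g} a_x·x` and `R₀ = R_1`, one has for every `g ∈ E` and every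
simple `z`:
`∑_{x,y : deg x = deg y = g} a_x·a_y·N^z_{xy} = (∑_{w ∈ C_g} a_w²)·d(z)` if
`deg z = 1`, and `= 0` otherwise; i.e. `R_g ⊗ R_g = (∑_{w ∈ C_g} a_w²)·R₀`.
If moreover the grading is faithful, then
`∑_{w ∈ C_g} a_w² = dim(C_0)/n_g` where `dim(C_0) = ∑_{x ∈ C_1} d(x)²`.
(Here `N x y z` denotes `N^z_{xy}`.) -/
theorem Rg_squared
    {I : Type*} [Fintype I] [DecidableEq I]
    {E : Type*} [Group E] [DecidableEq E]
    (hE2 : ∀ g : E, g * g = 1)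
    (one : I) (star : I → I) (N : I → I → I → ℕ)
    (h_star_one : star one = one)
    (h_assoc : ∀ x y z u : I,
      ∑ w : I, N x y w * N w z u = ∑ w : I, N y z w * N x w u)
    (h_one_left : ∀ x y : I, N one x y = if x = y then 1 else 0)
    (h_one_right : ∀ x y : I, N x one y = if x = y then 1 else 0)
    (h_frob₁ : ∀ x y z : I, N x y z = N (star x) z y)
    (h_frob₂ : ∀ x y z : I, N x y z = N z (star y) x)
    (d : I → ℝ)
    (hd_pos : ∀ x, 0 < d x)
    (hd_star : ∀ x, d (star x) = d x)
    (hd_mul : ∀ x y, d x * d y = ∑ z : I, (N x y z : ℝ) * d z)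
    (deg : I → E)
    (hdeg_one : deg one = 1)
    (hdeg_star : ∀ x, deg (star x) = (deg x)⁻¹)
    (hdeg_mul : ∀ x y z, 0 < N x y z → deg z = deg x * deg y)
    (n : E → ℕ) (a : I → ℕ)
    (hn_sqfree : ∀ g, Squarefree (n g)) (hn_pos : ∀ g, 0 < n g)
    (hn_one : n 1 = 1)
    (ha_pos : ∀ x, 0 < a x)
    (hd_eq : ∀ x, d x = (a x : ℝ) * Real.sqrt (n (deg x))) :
    (∀ (g : E) (z : I),
      (∑ x ∈ Finset.univ.filter (fun x => deg x = g),
        ∑ y ∈ Finset.univ.filter (fun y => deg y = g),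
          (a x : ℝ) * (a y : ℝ) * (N x y z : ℝ))
        = if deg z = 1 then
            (∑ w ∈ Finset.univ.filter (fun w => deg w = g), (a w : ℝ) ^ 2) * d z
          else 0) ∧
    ((∀ g : E, ∃ x : I, deg x = g) →
      ∀ g : E,
        (∑ w ∈ Finset.univ.filter (fun w => deg w = g), (a w : ℝ) ^ 2)
          = (∑ x ∈ Finset.univ.filter (fun x => deg x = 1), d x ^ 2) / (n g : ℝ)) := by
  constructor
  · intro g z
    split_ifs with hz
    · have hs : √(n g : ℝ) ≠ 0 := (Real.sqrt_pos.2 (Nat.cast_pos.2 (hn_pos g))).ne'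
      rw [Finset.sum_mul]
      refine Finset.sum_congr rfl fun x hx => ?_
      rw [Finset.mem_filter] at hx
      have hdeg : deg (star x) * deg z = g := by
        rw [hdeg_star, hx.2, hz, mul_one, inv_eq_of_mul_eq_one_left (hE2 g)]
      have key := sum_filter_deg_fusion_mul_dim hd_mul hdeg_mul hdeg
      rw [hd_star, hd_eq x, hx.2] at key
      refine mul_right_cancel₀ hs ?_
      calc _ = (a x : ℝ) * ∑ y ∈ Finset.univ.filter (fun y => deg y = g),
                (N (star x) z y : ℝ) * d y := by
            rw [Finset.sum_mul, Finset.mul_sum]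
            refine Finset.sum_congr rfl fun y hy => ?_
            rw [Finset.mem_filter] at hy
            rw [hd_eq y, hy.2, h_frob₁ x y z]
            ring
        _ = _ := by
            rw [key]
            ring
    · refine Finset.sum_eq_zero fun x hx => Finset.sum_eq_zero fun y hy => ?_
      rw [Finset.mem_filter] at hx hy
      have hN : N x y z = 0 := by
        by_contra h
        exact hz (by rw [hdeg_mul x y z (Nat.pos_of_ne_zero h), hx.2, hy.2, hE2])
      simp [hN]
  · intro hfaithful g
    obtain ⟨x, rfl⟩ := hfaithful g
    rw [eq_div_iff (Nat.cast_ne_zero.2 (hn_pos _).ne'),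
      ← sum_filter_deg_dim_sq h_frob₁ hd_pos hd_star hd_mul hdeg_star hdeg_mul x, Finset.sum_mul]
    refine Finset.sum_congr rfl fun y hy => ?_
    rw [Finset.mem_filter] at hy
    rw [hd_eq y, hy.2, mul_pow, Real.sq_sqrt (Nat.cast_nonneg _)]
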